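/- In the exterior algebra of ℂ⁵ with standard basis f₁,…,f₅, set θ₁ = f₂∧f₅ − f₃∧f₄, θ₂ = f₁∧f₅ − f₂∧f₄, θ₃ = f₂∧f₃ − f₁∧f₄, θ₄ = f₄∧f₅ − f₁∧f₂. Let i, j ∈ ℂ satisfy i² = −1 and j² + j + 1 = 0. Then the following identities hold: θ₂ + iθ₄ = (−i)·(f₁+if₄)∧(f₂+if₅); θ₂ − iθ₄ = i·(f₁−if₄)∧(f₂−if₅); θ₁ + θ₃ + θ₄ = (f₂+f₄)∧(f₁+f₃+f₅); θ₁ + jθ₃ + j²θ₄ = j²·(f₂+j²f₄)∧(f₁+j²f₃+jf₅); θ₁ + j²θ₃ + jθ₄ = j·(f₂+jf₄)∧(f₁+jf₃+j²f₅). In particular, the contraction of Ozeki's tensor at each of the five points p₁ = e₂+ie₄, p₂ = e₂−ie₄, p₃ = e₁+e₃+e₄, p₄ = e₁+je₃+j²e₄, p₅ = e₁+j²e₃+je₄ is a nonzero decomposable (rank-two) 2-vector. -/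

import Mathlib

open ExteriorAlgebra

/-- The generators `f₁, …, f₅` of the exterior algebra of `ℂ⁵` (0-indexed). -/
noncomputable def f (k : Fin 5) : ExteriorAlgebra ℂ (Fin 5 → ℂ) :=
  ι ℂ (Pi.single k 1)

/-- `θ₁ = f₂∧f₅ − f₃∧f₄`, the first component of Ozeki's tensor. -/
noncomputable def θ₁ : ExteriorAlgebra ℂ (Fin 5 → ℂ) := f 1 * f 4 - f 2 * f 3

/-- `θ₂ = f₁∧f₅ − f₂∧f₄`, the second component of Ozeki's tensor. -/
noncomputable def θ₂ : ExteriorAlgebra ℂ (Fin 5 → ℂ) := f 0 * f 4 - f 1 * f 3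

/-- `θ₃ = f₂∧f₃ − f₁∧f₄`, the third component of Ozeki's tensor. -/
noncomputable def θ₃ : ExteriorAlgebra ℂ (Fin 5 → ℂ) := f 1 * f 2 - f 0 * f 3

/-- `θ₄ = f₄∧f₅ − f₁∧f₂`, the fourth component of Ozeki's tensor. -/
noncomputable def θ₄ : ExteriorAlgebra ℂ (Fin 5 → ℂ) := f 3 * f 4 - f 0 * f 1

/-- The generators anticommute. -/
theorem f_swap (a b : Fin 5) : f a * f b = -(f b * f a) := by
  have h := CliffordAlgebra.ι_mul_ι_add_swap (Q := (0 : QuadraticForm ℂ (Fin 5 → ℂ)))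
    (Pi.single a 1) (Pi.single b 1)
  rw [eq_neg_iff_add_eq_zero]
  simpa [f, ExteriorAlgebra.ι, QuadraticMap.polar] using h

/-- A product of two vectors with a nonzero `(0,1)` minor is nonzero. -/
theorem wedge_ne_zero (u v : Fin 5 → ℂ) (h : u 0 * v 1 - u 1 * v 0 ≠ 0) :
    ι ℂ u * ι ℂ v ≠ 0 := by
  intro h0
  let d (k : Fin 5) : Module.Dual ℂ (Fin 5 → ℂ) := LinearMap.proj k
  have h1 := congrArg (fun x => CliffordAlgebra.contractLeft (d 1)
    (CliffordAlgebra.contractLeft (Q := (0 : QuadraticForm ℂ (Fin 5 → ℂ))) (d 0) x)) h0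
  simp only [ExteriorAlgebra.ι, CliffordAlgebra.contractLeft_ι_mul,
    CliffordAlgebra.contractLeft_ι, map_sub, map_smul, map_zero,
    CliffordAlgebra.contractLeft_algebraMap, d, LinearMap.proj_apply] at h1
  apply h
  apply (ExteriorAlgebra.algebraMap_leftInverse (R := ℂ) (Fin 5 → ℂ)).injective
  rw [map_zero, ← h1]
  simp only [map_sub, map_mul, Algebra.smul_def]
  erw [mul_zero, sub_zero]

/-- The contractions of Ozeki's tensor at the five points `p₁, …, p₅` are nonzero
decomposable 2-vectors `ω₁, …, ω₅`. -/
theorem ozeki_contractions_decomposable (i j : ℂ) (hi : i ^ 2 = -1)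
    (hj : j ^ 2 + j + 1 = 0) :
    (θ₂ + i • θ₄ = (-i) • ((f 0 + i • f 3) * (f 1 + i • f 4)) ∧
      (f 0 + i • f 3) * (f 1 + i • f 4) ≠ 0) ∧
    (θ₂ - i • θ₄ = i • ((f 0 - i • f 3) * (f 1 - i • f 4)) ∧
      (f 0 - i • f 3) * (f 1 - i • f 4) ≠ 0) ∧
    (θ₁ + θ₃ + θ₄ = (f 1 + f 3) * (f 0 + f 2 + f 4) ∧
      (f 1 + f 3) * (f 0 + f 2 + f 4) ≠ 0) ∧
    (θ₁ + j • θ₃ + j ^ 2 • θ₄ =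
        j ^ 2 • ((f 1 + j ^ 2 • f 3) * (f 0 + j ^ 2 • f 2 + j • f 4)) ∧
      (f 1 + j ^ 2 • f 3) * (f 0 + j ^ 2 • f 2 + j • f 4) ≠ 0) ∧
    (θ₁ + j ^ 2 • θ₃ + j • θ₄ =
        j • ((f 1 + j • f 3) * (f 0 + j • f 2 + j ^ 2 • f 4)) ∧
      (f 1 + j • f 3) * (f 0 + j • f 2 + j ^ 2 • f 4) ≠ 0) := by
  have hi3 : i ^ 3 = -i := by linear_combination i * hi
  have hj3 : j ^ 3 = 1 := by linear_combination (j - 1) * hj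
  have s10 := f_swap 1 0
  have s31 := f_swap 3 1
  have s30 := f_swap 3 0
  have s32 := f_swap 3 2
  refine ⟨⟨?_, ?_⟩, ⟨?_, ?_⟩, ⟨?_, ?_⟩, ⟨?_, ?_⟩, ⟨?_, ?_⟩⟩
  · simp only [θ₂, θ₄, mul_add, add_mul, smul_mul_assoc, mul_smul_comm, s31]
    match_scalars <;>
    first
      | ring1
      | linear_combination hi | linear_combination -hi | linear_combination i * hi | linear_combination -i * hi
  · have := wedge_ne_zero (Pi.single 0 1 + i • Pi.single 3 1) (Pi.single 1 1 + i • Pi.single 4 1)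
      (by simp)
    simpa only [f, map_add, map_smul] using this
  · simp only [θ₂, θ₄, mul_sub, sub_mul, smul_mul_assoc, mul_smul_comm, s31]
    match_scalars <;>
    first
      | ring1
      | linear_combination hi | linear_combination -hi | linear_combination i * hi | linear_combination -i * hi
  · have := wedge_ne_zero (Pi.single 0 1 - i • Pi.single 3 1) (Pi.single 1 1 - i • Pi.single 4 1)
      (by simp)
    simpa only [f, map_sub, map_smul] using this
  · simp only [θ₁, θ₃, θ₄, mul_add, add_mul, s10, s30, s32]
    abel
  · have := wedge_ne_zero (Pi.single 1 1 + Pi.single 3 1)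
      (Pi.single 0 1 + Pi.single 2 1 + Pi.single 4 1) (by simp)
    simpa only [f, map_add, map_smul] using this
  · simp only [θ₁, θ₃, θ₄, mul_add, add_mul, smul_mul_assoc, mul_smul_comm, s10, s30, s32]
    match_scalars <;>
    first
      | ring1
      | linear_combination hj3 | linear_combination -hj3 | linear_combination j * hj3 | linear_combination -j * hj3
      | linear_combination j ^ 2 * hj3 | linear_combination -j ^ 2 * hj3 | linear_combination (j ^ 3 + 1) * hj3 | linear_combination -(j ^ 3 + 1) * hj3
  · have := wedge_ne_zero (Pi.single 1 1 + j ^ 2 • Pi.single 3 1)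
      (Pi.single 0 1 + j ^ 2 • Pi.single 2 1 + j • Pi.single 4 1) (by simp)
    simpa only [f, map_add, map_smul] using this
  · simp only [θ₁, θ₃, θ₄, mul_add, add_mul, smul_mul_assoc, mul_smul_comm, s10, s30, s32]
    match_scalars <;>
    first
      | ring1
      | linear_combination hj3 | linear_combination -hj3 | linear_combination j * hj3 | linear_combination -j * hj3
  · have := wedge_ne_zero (Pi.single 1 1 + j • Pi.single 3 1)
      (Pi.single 0 1 + j • Pi.single 2 1 + j ^ 2 • Pi.single 4 1) (by simp)
    simpa only [f, map_add, map_smul] using this
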